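/- arXiv:1310.3086 — 3 statements merged into one kernel-verified Lean document; each statement's English description precedes it below -/
import Mathlib

section
/- Let σ ∈ ℝ, a ∈ ℝ, ν > 0, and let m = ⌈ν⌉ be the smallest integer with m ≥ ν. If f : [a,∞) → ℝ is continuous, then for all x > a, D_s^ν[I_s^ν f](x) = f(x), i.e., the fractional substantial derivative is a left inverse of the fractional substantial integral of the same order. -/
open MeasureTheory Set

/-- The fractional substantial integral of order `ν` with lower terminal `a`
(`I_s^0 f = f`; for `ν ≠ 0`,
`I_s^ν f(x) = (1/Γ(ν)) ∫_a^x (x−τ)^(ν−1) e^{−σ(x−τ)} f(τ) dτ`). -/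
noncomputable def Isub (σ a ν : ℝ) (f : ℝ → ℝ) : ℝ → ℝ :=
  if ν = 0 then f else
    fun x => (1 / Real.Gamma ν) * ∫ τ in a..x, (x - τ) ^ (ν - 1) * Real.exp (-σ * (x - τ)) * f τ

/-- The substantial derivative operator `D_s f = f′ + σ f`. -/
noncomputable def Dsub (σ : ℝ) (f : ℝ → ℝ) : ℝ → ℝ := fun x => deriv f x + σ * f x

/-- The fractional substantial derivative of order `μ`:
`D_s^μ f = D_s^m [I_s^{m−μ} f]` with `m = ⌈μ⌉` the smallest integer `≥ μ`. -/
noncomputable def Dfrac (σ a μ : ℝ) (f : ℝ → ℝ) : ℝ → ℝ :=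
  (Dsub σ)^[⌈μ⌉₊] (Isub σ a ((⌈μ⌉₊ : ℝ) - μ) f)

/-- The Beta integral over an arbitrary interval. -/
lemma integral_rpow_mul_rpow_eq_Gamma {α β c d : ℝ} (hα : 0 < α) (hβ : 0 < β) (hcd : c < d) :
    ∫ t in c..d, (d - t) ^ (α - 1) * (t - c) ^ (β - 1) =
      Real.Gamma α * Real.Gamma β / Real.Gamma (α + β) * (d - c) ^ (α + β - 1) := by
  have hdc : 0 < d - c := sub_pos.2 hcd
  have hs := Complex.betaIntegral_scaled (β : ℂ) (α : ℂ) hdc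
  rw [Complex.betaIntegral_eq_Gamma_mul_div _ _ (by simpa) (by simpa)] at hs
  have hshift : ∫ t in c..d, (d - t) ^ (α - 1) * (t - c) ^ (β - 1) =
      ∫ u in (0 : ℝ)..(d - c), u ^ (β - 1) * ((d - c) - u) ^ (α - 1) := by
    rw [← sub_self c, ← intervalIntegral.integral_comp_sub_right
      (fun u => u ^ (β - 1) * ((d - c) - u) ^ (α - 1)) c]
    refine intervalIntegral.integral_congr fun t _ => ?_
    simp only [sub_sub_sub_cancel_right, mul_comm]
  rw [hshift]
  apply Complex.ofReal_injective
  rw [← intervalIntegral.integral_ofReal]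
  have hcongr : ∫ u in (0 : ℝ)..(d - c), ((u ^ (β - 1) * ((d - c) - u) ^ (α - 1) : ℝ) : ℂ) =
      ∫ u in (0 : ℝ)..(d - c), (u : ℂ) ^ ((β : ℂ) - 1) *
        (((d - c : ℝ) : ℂ) - u) ^ ((α : ℂ) - 1) := by
    refine intervalIntegral.integral_congr fun u hu => ?_
    rw [uIcc_of_le hdc.le] at hu
    simp only [Complex.ofReal_mul]
    rw [Complex.ofReal_cpow hu.1, Complex.ofReal_cpow (sub_nonneg.2 hu.2)]
    push_cast
    rfl
  rw [hcongr, hs, Complex.ofReal_mul, Complex.ofReal_cpow hdc.le]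
  simp only [← Complex.ofReal_add, Complex.Gamma_ofReal]
  push_cast
  rw [add_comm (β : ℂ) α, add_comm β α]
  ring

lemma integrable_indicator_Ico_rpow {r : ℝ} (hr : 0 < r) (L : ℝ) :
    Integrable ((Ico 0 L).indicator fun u : ℝ => u ^ (r - 1)) := by
  rw [integrable_indicator_iff measurableSet_Ico]
  rcases le_total 0 L with hL | hL
  · have h := intervalIntegral.intervalIntegrable_rpow' (a := 0) (b := L) (r := r - 1) (by linarith)
    rwa [intervalIntegrable_iff_integrableOn_Ico_of_le hL] at h
  · simp [Ico_eq_empty_of_le hL]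

lemma Isub_of_ne_zero {ν : ℝ} (hν : ν ≠ 0) (σ a : ℝ) (f : ℝ → ℝ) (x : ℝ) :
    Isub σ a ν f x = (1 / Real.Gamma ν) *
      ∫ τ in a..x, (x - τ) ^ (ν - 1) * Real.exp (-σ * (x - τ)) * f τ := by
  simp [Isub, hν]

lemma Isub_congr {a : ℝ} {f g : ℝ → ℝ} (h : EqOn f g (Ici a)) (σ ν : ℝ) :
    EqOn (Isub σ a ν f) (Isub σ a ν g) (Ici a) := by
  intro x hx
  by_cases hν : ν = 0
  · simpa [Isub, hν] using h hx
  · rw [Isub_of_ne_zero hν, Isub_of_ne_zero hν]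
    congr 1
    refine intervalIntegral.integral_congr fun τ hτ => ?_
    rw [uIcc_of_le hx] at hτ
    simp only [h hτ.1]

lemma exists_continuous_eqOn_Ici {a : ℝ} {f : ℝ → ℝ} (hf : ContinuousOn f (Ici a)) :
    ∃ g : ℝ → ℝ, Continuous g ∧ EqOn f g (Ici a) := by
  refine ⟨fun x => f (max a x), ?_, fun x hx => ?_⟩
  · exact hf.comp_continuous (by fun_prop) fun x => le_max_left a x
  · simp [max_eq_right (mem_Ici.1 hx)]

/-- The semigroup law for fractional substantial integrals of continuous functions on `ℝ`. -/
lemma Isub_Isub_of_continuous {σ a α β : ℝ} (hα : 0 < α) (hβ : 0 < β) {f : ℝ → ℝ}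
    (hf : Continuous f) {x : ℝ} (hx : a < x) :
    Isub σ a α (Isub σ a β f) x = Isub σ a (α + β) f x := by
  set p : ℝ → ℝ → ℝ := fun r => (Ico 0 (x - a)).indicator fun u : ℝ => u ^ (r - 1)
  set b : ℝ → ℝ := (Ioc a x).indicator fun τ => Real.exp (-σ * (x - τ)) * f τ with hb
  have hbcont : Continuous fun τ => Real.exp (-σ * (x - τ)) * f τ := by fun_prop
  obtain ⟨C, hC⟩ := (isCompact_Icc (a := a) (b := x)).exists_bound_of_continuousOn
    hbcont.continuousOn
  have hC0 : 0 ≤ C := (norm_nonneg _).trans (hC a (left_mem_Icc.2 hx.le))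
  have hbmeas : Measurable b := hbcont.measurable.indicator measurableSet_Ioc
  have hbC : ∀ τ, ‖b τ‖ ≤ C := by
    intro τ
    by_cases hτ : τ ∈ Ioc a x
    · simpa [hb, hτ] using hC τ (Ioc_subset_Icc_self hτ)
    · simpa [hb, hτ] using hC0
  have hint : Integrable (Function.uncurry fun t τ => p α (x - t) * p β (t - τ) * b τ)
      (volume.prod volume) := by
    have h1 : Integrable fun t => p α (x - t) :=
      (integrable_indicator_Ico_rpow hα (x - a)).comp_sub_left x
    have h2 : Integrable fun s => p β (-s) := (integrable_indicator_Ico_rpow hβ (x - a)).comp_neg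
    have h3 := (h1.convolution_integrand (ContinuousLinearMap.mul ℝ ℝ) h2).swap
    refine Integrable.mul_bdd (c := C) ?_ (hbmeas.comp measurable_snd).aestronglyMeasurable
      (Filter.Eventually.of_forall fun q => hbC q.2)
    refine h3.congr (Filter.Eventually.of_forall fun q => ?_)
    simp
  have hswap := integral_integral_swap hint
  have hleft : ∀ t, ∫ τ, p α (x - t) * p β (t - τ) * b τ = (Ioc a x).indicator (fun t =>
      (x - t) ^ (α - 1) * Real.exp (-σ * (x - t)) *
        ∫ τ in a..t, (t - τ) ^ (β - 1) * Real.exp (-σ * (t - τ)) * f τ) t := by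
    intro t
    by_cases ht : t ∈ Ioc a x
    · rw [indicator_of_mem ht, intervalIntegral.integral_of_le ht.1.le, ← integral_const_mul,
        ← integral_indicator measurableSet_Ioc]
      congr 1
      ext τ
      have h1 : p α (x - t) = (x - t) ^ (α - 1) :=
        indicator_of_mem (s := Ico 0 (x - a)) ⟨by linarith [ht.2], by linarith [ht.1]⟩ _
      by_cases hτ : τ ∈ Ioc a t
      · have h2 : p β (t - τ) = (t - τ) ^ (β - 1) :=
          indicator_of_mem (s := Ico 0 (x - a)) ⟨by linarith [hτ.2], by linarith [hτ.1, ht.2]⟩ _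
        have h3 : b τ = Real.exp (-σ * (x - τ)) * f τ :=
          indicator_of_mem (s := Ioc a x) ⟨hτ.1, hτ.2.trans ht.2⟩ _
        have h4 : -σ * (x - τ) = -σ * (x - t) + -σ * (t - τ) := by ring
        rw [indicator_of_mem hτ, h1, h2, h3, h4, Real.exp_add]
        ring
      · rw [indicator_of_notMem hτ]
        by_cases hτa : a < τ
        · have h2 : p β (t - τ) = 0 :=
            indicator_of_notMem (fun h => hτ ⟨hτa, by linarith [h.1]⟩) _
          simp [h2]
        · have h3 : b τ = 0 := indicator_of_notMem (fun h => hτa h.1) _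
          simp [h3]
    · have h1 : p α (x - t) = 0 :=
        indicator_of_notMem (fun h => ht ⟨by linarith [h.2], by linarith [h.1]⟩) _
      simp [ht, h1]
  have hright : ∀ τ, τ ≠ x → ∫ t, p α (x - t) * p β (t - τ) * b τ = (Ioc a x).indicator (fun τ =>
      Real.Gamma α * Real.Gamma β / Real.Gamma (α + β) *
        ((x - τ) ^ (α + β - 1) * Real.exp (-σ * (x - τ)) * f τ)) τ := by
    intro τ hτx
    by_cases hτ : τ ∈ Ioc a x
    · have hlt : τ < x := lt_of_le_of_ne hτ.2 hτx
      have h3 : b τ = Real.exp (-σ * (x - τ)) * f τ := indicator_of_mem hτ _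
      have h4 : ∫ t, p α (x - t) * p β (t - τ) =
          ∫ t in τ..x, (x - t) ^ (α - 1) * (t - τ) ^ (β - 1) := by
        rw [intervalIntegral.integral_of_le hlt.le, ← integral_Icc_eq_integral_Ioc,
          ← integral_indicator measurableSet_Icc]
        congr 1
        ext t
        by_cases ht : t ∈ Icc τ x
        · have h1 : p α (x - t) = (x - t) ^ (α - 1) :=
            indicator_of_mem (s := Ico 0 (x - a)) ⟨by linarith [ht.2], by linarith [ht.1, hτ.1]⟩ _
          have h2 : p β (t - τ) = (t - τ) ^ (β - 1) :=
            indicator_of_mem (s := Ico 0 (x - a)) ⟨by linarith [ht.1], by linarith [ht.2, hτ.1]⟩ _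
          rw [indicator_of_mem ht, h1, h2]
        · rw [indicator_of_notMem ht]
          by_cases htτ : τ ≤ t
          · have h1 : p α (x - t) = 0 :=
              indicator_of_notMem (fun h => ht ⟨htτ, by linarith [h.1]⟩) _
            simp [h1]
          · have h2 : p β (t - τ) = 0 :=
              indicator_of_notMem (fun h => htτ (by linarith [h.1])) _
            simp [h2]
      rw [integral_mul_const, h4, integral_rpow_mul_rpow_eq_Gamma hα hβ hlt,
        indicator_of_mem hτ, h3]
      ring
    · have h3 : b τ = 0 := indicator_of_notMem hτ _
      simp [hτ, h3]
  simp_rw [hleft] at hswap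
  rw [integral_congr_ae ((volume.ae_ne x).mono hright),
    integral_indicator measurableSet_Ioc, integral_indicator measurableSet_Ioc,
    integral_const_mul] at hswap
  have hαβ : 0 < α + β := add_pos hα hβ
  have hlhs : ∀ t, (x - t) ^ (α - 1) * Real.exp (-σ * (x - t)) * Isub σ a β f t =
      1 / Real.Gamma β * ((x - t) ^ (α - 1) * Real.exp (-σ * (x - t)) *
        ∫ τ in a..t, (t - τ) ^ (β - 1) * Real.exp (-σ * (t - τ)) * f τ) := by
    intro t
    rw [Isub_of_ne_zero hβ.ne']
    ring
  rw [Isub_of_ne_zero hα.ne', Isub_of_ne_zero hαβ.ne']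
  simp_rw [hlhs]
  rw [intervalIntegral.integral_const_mul, intervalIntegral.integral_of_le hx.le,
    intervalIntegral.integral_of_le hx.le, hswap]
  generalize (∫ τ in Ioc a x, (x - τ) ^ (α + β - 1) * Real.exp (-σ * (x - τ)) * f τ) = J
  have hΓα := (Real.Gamma_pos_of_pos hα).ne'
  have hΓβ := (Real.Gamma_pos_of_pos hβ).ne'
  field_simp

lemma Isub_self {ν : ℝ} (hν : ν ≠ 0) (σ a : ℝ) (f : ℝ → ℝ) : Isub σ a ν f a = 0 := by
  simp [Isub_of_ne_zero hν]

/-- The semigroup law for fractional substantial integrals. -/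
lemma Isub_Isub {σ a α β : ℝ} (hα : 0 ≤ α) (hβ : 0 ≤ β) {f : ℝ → ℝ}
    (hf : ContinuousOn f (Ici a)) :
    EqOn (Isub σ a α (Isub σ a β f)) (Isub σ a (α + β) f) (Ici a) := by
  intro x hx
  rcases hα.eq_or_lt with rfl | hα
  · simp [Isub]
  rcases hβ.eq_or_lt with rfl | hβ
  · simp [Isub]
  rcases (mem_Ici.1 hx).eq_or_lt with rfl | hx'
  · rw [Isub_self hα.ne', Isub_self (add_pos hα hβ).ne']
  obtain ⟨g, hg, hfg⟩ := exists_continuous_eqOn_Ici hf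
  rw [Isub_congr (Isub_congr hfg σ β) σ α hx, Isub_congr hfg σ (α + β) hx,
    Isub_Isub_of_continuous hα hβ hg hx']

lemma hasDerivAt_Isub_one (σ a : ℝ) {f : ℝ → ℝ} (hf : Continuous f) (x : ℝ) :
    HasDerivAt (Isub σ a 1 f) (f x - σ * Isub σ a 1 f x) x := by
  have h : Isub σ a 1 f =
      fun x => Real.exp (-σ * x) * ∫ τ in a..x, Real.exp (σ * τ) * f τ := by
    ext y
    rw [Isub_of_ne_zero one_ne_zero]
    simp only [Real.Gamma_one, div_one, one_mul, sub_self, Real.rpow_zero]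
    rw [← intervalIntegral.integral_const_mul]
    refine intervalIntegral.integral_congr fun τ _ => ?_
    have h4 : -σ * (y - τ) = -σ * y + σ * τ := by ring
    simp only [h4, Real.exp_add]
    ring
  have hc : Continuous fun τ => Real.exp (σ * τ) * f τ := by fun_prop
  have h1 : HasDerivAt (fun x : ℝ => Real.exp (-σ * x)) (Real.exp (-σ * x) * (-σ * 1)) x :=
    ((hasDerivAt_id x).const_mul (-σ)).exp
  have h2 := h1.mul (hc.integral_hasStrictDerivAt a x).hasDerivAt
  have h3 : Real.exp (-σ * x) * Real.exp (σ * x) = 1 := by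
    rw [← Real.exp_add]
    simp
  rw [h]
  refine h2.congr_deriv ?_
  linear_combination f x * h3

lemma continuousOn_Isub_one (σ : ℝ) {a : ℝ} {f : ℝ → ℝ} (hf : ContinuousOn f (Ici a)) :
    ContinuousOn (Isub σ a 1 f) (Ici a) := by
  obtain ⟨g, hg, hfg⟩ := exists_continuous_eqOn_Ici hf
  refine ContinuousOn.congr ?_ (Isub_congr hfg σ 1)
  exact fun x _ => (hasDerivAt_Isub_one σ a hg x).continuousAt.continuousWithinAt

lemma continuousOn_Isub_natCast (σ : ℝ) {a : ℝ} {f : ℝ → ℝ} (hf : ContinuousOn f (Ici a)) (n : ℕ) :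
    ContinuousOn (Isub σ a n f) (Ici a) := by
  induction n with
  | zero => simpa [Isub] using hf
  | succ n ih =>
    refine (continuousOn_Isub_one σ ih).congr fun x hx => ?_
    rw [Isub_Isub zero_le_one n.cast_nonneg hf hx, Nat.cast_succ, add_comm]

lemma Dsub_congr {σ a : ℝ} {f g : ℝ → ℝ} (h : EqOn f g (Ioi a)) :
    EqOn (Dsub σ f) (Dsub σ g) (Ioi a) := by
  intro x hx
  have he : f =ᶠ[nhds x] g := h.eventuallyEq_of_mem (Ioi_mem_nhds hx)
  simp only [Dsub, he.deriv_eq, h hx]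

lemma Dsub_iterate_congr {σ a : ℝ} {f g : ℝ → ℝ} (h : EqOn f g (Ioi a)) (n : ℕ) :
    EqOn ((Dsub σ)^[n] f) ((Dsub σ)^[n] g) (Ioi a) := by
  induction n with
  | zero => exact h
  | succ n ih =>
    rw [Function.iterate_succ_apply', Function.iterate_succ_apply']
    exact Dsub_congr ih

lemma Dsub_Isub_one (σ : ℝ) {a : ℝ} {f : ℝ → ℝ} (hf : ContinuousOn f (Ici a)) :
    EqOn (Dsub σ (Isub σ a 1 f)) f (Ioi a) := by
  obtain ⟨g, hg, hfg⟩ := exists_continuous_eqOn_Ici hf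
  intro x hx
  rw [Dsub_congr ((Isub_congr hfg σ 1).mono Ioi_subset_Ici_self) hx, hfg (Ioi_subset_Ici_self hx),
    Dsub, (hasDerivAt_Isub_one σ a hg x).deriv]
  ring

lemma Dsub_iterate_Isub_natCast (σ : ℝ) {a : ℝ} {f : ℝ → ℝ} (hf : ContinuousOn f (Ici a)) (n : ℕ) :
    EqOn ((Dsub σ)^[n] (Isub σ a n f)) f (Ioi a) := by
  induction n with
  | zero => simp [Isub, EqOn]
  | succ n ih =>
    rw [Function.iterate_succ_apply]
    refine (Dsub_iterate_congr ?_ n).trans ih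
    refine EqOn.trans (Dsub_congr fun x hx => ?_)
      (Dsub_Isub_one σ (continuousOn_Isub_natCast σ hf n))
    rw [Isub_Isub zero_le_one n.cast_nonneg hf (Ioi_subset_Ici_self hx), Nat.cast_succ, add_comm]

/-- Lemma 2.3: `D_s^ν [I_s^ν f] = f` for continuous `f`. -/
theorem substantial_derivative_left_inverse
    (σ a ν : ℝ) (hν : 0 < ν) (f : ℝ → ℝ) (hf : ContinuousOn f (Set.Ici a)) :
    ∀ x > a, Dfrac σ a ν (Isub σ a ν f) x = f x := by
  intro x hx
  have hsemi := Isub_Isub (σ := σ) (sub_nonneg.2 (Nat.le_ceil ν)) hν.le hf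
  rw [sub_add_cancel] at hsemi
  rw [Dfrac, Dsub_iterate_congr (hsemi.mono Ioi_subset_Ici_self) _ hx,
    Dsub_iterate_Isub_natCast σ hf _ hx]
end

section
/- Let σ ∈ ℝ, a ∈ ℝ, let ν > 0 be non-integer with m = ⌈ν⌉, and let f : [a,∞) → ℝ be m-times continuously differentiable with D_s^ν f integrable near a. Suppose the limits [D_s^{ν−j} f]_{x=a} := lim_{x→a⁺} D_s^{ν−j} f(x) exist for j = 1, …, m (where D_s^{ν−j} means I_s^{j−ν} when ν − j < 0, and D_s^0 f = f). Then for all x > a, I_s^ν[D_s^ν f](x) = f(x) − Σ_{j=1}^m [D_s^{ν−j} f]_{x=a} (x−a)^{ν−j} e^{−σ(x−a)} / Γ(ν−j+1). -/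
open MeasureTheory Set Filter

/-- `D_s^γ` for arbitrary real `γ`: the fractional substantial derivative when `γ > 0`,
the identity when `γ = 0`, and the fractional substantial integral `I_s^{−γ}` when `γ < 0`. -/
noncomputable def DIfrac (σ a γ : ℝ) (f : ℝ → ℝ) : ℝ → ℝ :=
  if 0 < γ then Dfrac σ a γ f else Isub σ a (-γ) f


/-- The Riemann–Liouville integral of order `α` with lower terminal `a`. -/
noncomputable def rlInt (a α : ℝ) (g : ℝ → ℝ) (x : ℝ) : ℝ :=
  (1 / Real.Gamma α) * ∫ τ in a..x, (x - τ) ^ (α - 1) * g τ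

lemma integral_sub_rpow_mul_rpow {α β s x : ℝ} (hα : 0 < α) (hβ : 0 < β) (hsx : s < x) :
    ∫ τ in s..x, (x - τ) ^ (β - 1) * (τ - s) ^ (α - 1) =
      (x - s) ^ (α + β - 1) * (Real.Gamma α * Real.Gamma β / Real.Gamma (α + β)) := by
  have h0 : 0 < x - s := sub_pos.2 hsx
  have h1 := Complex.betaIntegral_scaled α β h0
  rw [Complex.betaIntegral_eq_Gamma_mul_div _ _ (by simpa) (by simpa)] at h1
  have h2 : ∫ t in (0 : ℝ)..(x - s), (t : ℂ) ^ ((α : ℂ) - 1) *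
        (((x - s : ℝ) : ℂ) - t) ^ ((β : ℂ) - 1) =
      ((∫ t in (0 : ℝ)..(x - s), t ^ (α - 1) * ((x - s) - t) ^ (β - 1) : ℝ) : ℂ) := by
    rw [← intervalIntegral.integral_ofReal]
    refine intervalIntegral.integral_congr fun t ht => ?_
    rw [uIcc_of_le h0.le] at ht
    have h3 : 0 ≤ x - s - t := sub_nonneg.2 ht.2
    push_cast [Complex.ofReal_cpow ht.1, Complex.ofReal_cpow h3]
    rfl
  rw [h2] at h1
  have h3 : (∫ t in (0 : ℝ)..(x - s), t ^ (α - 1) * ((x - s) - t) ^ (β - 1)) =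
      (x - s) ^ (α + β - 1) * (Real.Gamma α * Real.Gamma β / Real.Gamma (α + β)) := by
    rw [← Complex.ofReal_inj, h1]
    rw [← Complex.ofReal_add, Complex.Gamma_ofReal, Complex.Gamma_ofReal, Complex.Gamma_ofReal]
    rw [Complex.ofReal_mul, Complex.ofReal_cpow h0.le]
    push_cast
    rfl
  rw [← h3]
  have h4 := intervalIntegral.integral_comp_sub_right
    (fun t => t ^ (α - 1) * ((x - s) - t) ^ (β - 1)) s (a := s) (b := x)
  rw [sub_self] at h4
  rw [← h4]
  refine intervalIntegral.integral_congr fun t _ => ?_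
  simp only [sub_sub_sub_cancel_right]
  exact mul_comm _ _

lemma intervalIntegrable_sub_rpow_mul_rpow {α β s x : ℝ} (hα : 0 < α) (hβ : 0 < β) (hsx : s < x) :
    IntervalIntegrable (fun τ => (x - τ) ^ (β - 1) * (τ - s) ^ (α - 1)) volume s x := by
  by_contra h
  have h1 := integral_sub_rpow_mul_rpow hα hβ hsx
  rw [intervalIntegral.integral_undef h] at h1
  have := Real.Gamma_pos_of_pos hα
  have := Real.Gamma_pos_of_pos hβ
  have := Real.Gamma_pos_of_pos (add_pos hα hβ)
  have := Real.rpow_pos_of_pos (sub_pos.2 hsx) (α + β - 1)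
  have : 0 < (x - s) ^ (α + β - 1) * (Real.Gamma α * Real.Gamma β / Real.Gamma (α + β)) := by
    positivity
  exact this.ne h1

lemma intervalIntegrable_sub_rpow {α : ℝ} (hα : 0 < α) (s x : ℝ) :
    IntervalIntegrable (fun τ => (x - τ) ^ (α - 1)) volume s x := by
  have h := (intervalIntegral.intervalIntegrable_rpow' (a := x - s) (b := 0)
    (r := α - 1) (by linarith)).comp_sub_left x
  simpa using h

lemma intervalIntegrable_sub_rpow_mul {a α x : ℝ} {φ : ℝ → ℝ} (hα : 0 < α) (hx : a ≤ x)
    (hφ : ContinuousOn φ (Ici a)) :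
    IntervalIntegrable (fun τ => (x - τ) ^ (α - 1) * φ τ) volume a x :=
  (intervalIntegrable_sub_rpow hα a x).mul_continuousOn
    (hφ.mono (by rw [uIcc_of_le hx]; exact Icc_subset_Ici_self))

lemma rlInt_rpow {a α ν x : ℝ} (hα : 0 < α) (hν : 0 < ν) (hx : a < x) :
    rlInt a ν (fun τ => (τ - a) ^ (α - 1) / Real.Gamma α) x =
      (x - a) ^ (α + ν - 1) / Real.Gamma (α + ν) := by
  have h1 := (Real.Gamma_pos_of_pos hα).ne'
  have h2 := (Real.Gamma_pos_of_pos hν).ne'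
  simp only [rlInt, ← mul_div_assoc]
  rw [intervalIntegral.integral_div, integral_sub_rpow_mul_rpow hα hν hx]
  field_simp

lemma rlInt_rlInt {a α β x : ℝ} {φ : ℝ → ℝ} (hα : 0 < α) (hβ : 0 < β) (hx : a < x)
    (hφ : ContinuousOn φ (Ici a)) :
    rlInt a β (rlInt a α φ) x = rlInt a (α + β) φ x := by
  set μ : Measure ℝ := volume.restrict (Ioc a x) with hμ
  set k : ℝ → ℝ → ℝ := fun τ s => (Iio τ).indicator (fun s => (x - τ) ^ (β - 1) * (τ - s) ^ (α - 1)) s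
    with hk
  set B := Real.Gamma α * Real.Gamma β / Real.Gamma (α + β) with hB
  have hkm : Measurable (Function.uncurry k) := by
    have : Function.uncurry k = {p : ℝ × ℝ | p.2 < p.1}.indicator
        (fun p => (x - p.1) ^ (β - 1) * (p.1 - p.2) ^ (α - 1)) := by
      ext ⟨τ, s⟩
      simp [hk, indicator, Function.uncurry]
    rw [this]
    exact (by fun_prop : Measurable fun p : ℝ × ℝ =>
      (x - p.1) ^ (β - 1) * (p.1 - p.2) ^ (α - 1)).indicator
      (measurableSet_lt measurable_snd measurable_fst)
  have hφm : AEStronglyMeasurable φ μ :=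
    (hφ.mono fun _ h => h.1.le).aestronglyMeasurable measurableSet_Ioc
  have hkn : ∀ s, ∀ τ ∈ Ioc a x, 0 ≤ k τ s := fun s τ hτ => by
    refine indicator_apply_nonneg fun h => ?_
    exact mul_nonneg (Real.rpow_nonneg (sub_nonneg.2 hτ.2) _)
      (Real.rpow_nonneg (sub_nonneg.2 (mem_Iio.1 h).le) _)
  have hkeq : ∀ s, (fun τ => k τ s) =
      (Ioi s).indicator (fun τ => (x - τ) ^ (β - 1) * (τ - s) ^ (α - 1)) := fun s => by
    ext τ
    simp [hk, indicator]
  have hset : ∀ s ∈ Ioo a x, Ioi s ∩ Ioc a x = Ioc s x := fun s hs => by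
    ext t
    simp only [mem_inter_iff, mem_Ioi, mem_Ioc]
    have := hs.1
    constructor
    · rintro ⟨h, _, h'⟩; exact ⟨h, h'⟩
    · rintro ⟨h, h'⟩; exact ⟨h, this.trans h, h'⟩
  have hki : ∀ s ∈ Ioo a x, Integrable (fun τ => k τ s) μ := fun s hs => by
    rw [hkeq, integrable_indicator_iff measurableSet_Ioi, IntegrableOn, hμ,
      Measure.restrict_restrict measurableSet_Ioi, hset s hs]
    exact (intervalIntegrable_sub_rpow_mul_rpow hα hβ hs.2).1
  have hkv : ∀ s ∈ Ioo a x, ∫ τ, k τ s ∂μ = (x - s) ^ (α + β - 1) * B := fun s hs => by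
    rw [hkeq, integral_indicator measurableSet_Ioi, hμ,
      Measure.restrict_restrict measurableSet_Ioi, hset s hs,
      ← intervalIntegral.integral_of_le hs.2.le, integral_sub_rpow_mul_rpow hα hβ hs.2]
  have hae : ∀ᵐ s ∂μ, s ∈ Ioo a x := by
    rw [hμ, ← restrict_Ioo_eq_restrict_Ioc]
    exact ae_restrict_mem measurableSet_Ioo
  have hint : Integrable (Function.uncurry fun τ s => k τ s * φ s) (μ.prod μ) := by
    have hm : AEStronglyMeasurable (Function.uncurry fun τ s => k τ s * φ s) (μ.prod μ) :=
      hkm.aestronglyMeasurable.mul hφm.comp_snd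
    rw [integrable_prod_iff' hm]
    constructor
    · filter_upwards [hae] with s hs
      simpa only [Function.uncurry] using (hki s hs).mul_const (φ s)
    · have h1 : IntervalIntegrable (fun s => (x - s) ^ (α + β - 1) * (B * |φ s|)) volume a x :=
        intervalIntegrable_sub_rpow_mul (add_pos hα hβ) hx.le (continuousOn_const.mul hφ.abs)
      refine h1.1.congr ?_
      filter_upwards [hae] with s hs
      rw [← mul_assoc, ← hkv s hs, ← integral_mul_const]
      refine integral_congr_ae ?_
      filter_upwards [ae_restrict_mem measurableSet_Ioc] with τ hτ
      simp [Function.uncurry, abs_of_nonneg (hkn s τ hτ)]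
  have hswap := integral_integral_swap hint
  have hL : ∫ τ in a..x, (x - τ) ^ (β - 1) * rlInt a α φ τ =
      (1 / Real.Gamma α) * ∫ τ, ∫ s, k τ s * φ s ∂μ ∂μ := by
    rw [intervalIntegral.integral_of_le hx.le, ← integral_const_mul]
    refine setIntegral_congr_fun measurableSet_Ioc fun τ hτ => ?_
    have h1 : ∀ s, k τ s * φ s = (Iio τ).indicator
        (fun s => (x - τ) ^ (β - 1) * ((τ - s) ^ (α - 1) * φ s)) s := fun s => by
      by_cases h : s < τ <;> simp [hk, h, mul_assoc]
    have h2 : Iio τ ∩ Ioc a x = Ioo a τ := by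
      ext t
      simp only [mem_inter_iff, mem_Iio, mem_Ioc, mem_Ioo]
      have := hτ.2
      constructor
      · rintro ⟨h, h', _⟩; exact ⟨h', h⟩
      · rintro ⟨h, h'⟩; exact ⟨h', h, (h'.trans_le this).le⟩
    simp only [h1]
    rw [integral_indicator measurableSet_Iio, hμ, Measure.restrict_restrict measurableSet_Iio, h2,
      integral_const_mul, ← integral_Ioc_eq_integral_Ioo, rlInt,
      intervalIntegral.integral_of_le hτ.1.le]
    ring
  have hR : ∫ s, ∫ τ, k τ s * φ s ∂μ ∂μ = B * ∫ s in a..x, (x - s) ^ (α + β - 1) * φ s := by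
    rw [intervalIntegral.integral_of_le hx.le, ← integral_const_mul]
    refine integral_congr_ae ?_
    filter_upwards [hae] with s hs
    rw [integral_mul_const, hkv s hs]
    ring
  have h1 := (Real.Gamma_pos_of_pos hα).ne'
  have h2 := (Real.Gamma_pos_of_pos hβ).ne'
  rw [rlInt, hL, hswap, hR, rlInt, hB]
  field_simp

lemma continuousOn_rlInt {a α : ℝ} {φ : ℝ → ℝ} (hα : 0 < α) (hφ : ContinuousOn φ (Ici a)) :
    ContinuousOn (rlInt a α φ) (Ici a) := by
  have key : ∀ x ∈ Ici a, rlInt a α φ x =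
      (1 / Real.Gamma α) * ((x - a) ^ α *
        ∫ u in (0 : ℝ)..1, (1 - u) ^ (α - 1) * φ (a + (x - a) * u)) := fun x hx => by
    rcases eq_or_lt_of_le (show a ≤ x from hx) with rfl | hx
    · simp [rlInt, Real.zero_rpow hα.ne']
    rw [rlInt]
    congr 1
    have h0 : 0 < x - a := sub_pos.2 hx
    have h1 := intervalIntegral.mul_integral_comp_add_mul
      (f := fun τ => (x - τ) ^ (α - 1) * φ τ) (x - a) a (a := 0) (b := 1)
    simp only [mul_zero, add_zero, mul_one, add_sub_cancel] at h1
    rw [← h1, ← intervalIntegral.integral_const_mul, ← intervalIntegral.integral_const_mul]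
    refine intervalIntegral.integral_congr fun u hu => ?_
    rw [uIcc_of_le zero_le_one] at hu
    have h2 : x - (a + (x - a) * u) = (x - a) * (1 - u) := by ring
    rw [h2, Real.mul_rpow h0.le (sub_nonneg.2 hu.2), Real.rpow_sub_one h0.ne']
    field_simp
  refine ContinuousOn.congr ?_ key
  refine continuousOn_const.mul (ContinuousOn.mul ?_ ?_)
  · exact ContinuousOn.rpow_const (by fun_prop) fun _ _ => Or.inr hα.le
  intro x₀ hx₀
  obtain ⟨C, hC⟩ := isCompact_Icc.exists_bound_of_continuousOn
    (hφ.mono (Icc_subset_Ici_self : Icc a (x₀ + 1) ⊆ Ici a))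
  have hmem : ∀ x ∈ Ici a, ∀ u ∈ uIoc (0 : ℝ) 1, a ≤ a + (x - a) * u := fun x hx u hu => by
    rw [uIoc_of_le zero_le_one] at hu
    have := mul_nonneg (sub_nonneg.2 (show a ≤ x from hx)) hu.1.le
    linarith
  refine intervalIntegral.continuousWithinAt_of_dominated_interval
    (bound := fun u => (1 - u) ^ (α - 1) * C) ?_ ?_
    ((intervalIntegrable_sub_rpow hα 0 1).mul_const C) ?_
  · filter_upwards [self_mem_nhdsWithin] with x hx
    refine AEStronglyMeasurable.mul
      (by fun_prop : Measurable fun u : ℝ => (1 - u) ^ (α - 1)).aestronglyMeasurable ?_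
    exact ContinuousOn.aestronglyMeasurable
      (hφ.comp (by fun_prop) fun u hu => hmem x hx u hu) measurableSet_uIoc
  · filter_upwards [self_mem_nhdsWithin,
      mem_nhdsWithin_of_mem_nhds (Iio_mem_nhds (lt_add_one x₀))] with x hx hx'
    refine Eventually.of_forall fun u hu => ?_
    have h1 := hmem x hx u hu
    rw [uIoc_of_le zero_le_one] at hu
    have h2 : 0 ≤ (1 - u) ^ (α - 1) := Real.rpow_nonneg (sub_nonneg.2 hu.2) _
    rw [norm_mul, Real.norm_of_nonneg h2]
    refine mul_le_mul_of_nonneg_left (hC _ ⟨h1, ?_⟩) h2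
    have := mul_le_mul_of_nonneg_left hu.2 (sub_nonneg.2 (show a ≤ x from hx))
    have : x < x₀ + 1 := hx'
    linarith
  · refine Eventually.of_forall fun u hu => ?_
    refine continuousWithinAt_const.mul ?_
    exact ContinuousWithinAt.comp (t := Ici a) (hφ _ (hmem x₀ hx₀ u hu))
      (by fun_prop) fun x hx => hmem x hx u hu

lemma tendsto_rlInt_nhdsGT {a α : ℝ} {φ : ℝ → ℝ} (hα : 0 < α) (hφ : ContinuousOn φ (Ici a)) :
    Tendsto (rlInt a α φ) (nhdsWithin a (Ioi a)) (nhds 0) := by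
  have h := (continuousOn_rlInt hα hφ a self_mem_Ici).mono Ioi_subset_Ici_self
  simpa [ContinuousWithinAt, rlInt] using h

lemma hasDerivAt_rlInt_add_one {a α x : ℝ} {φ : ℝ → ℝ} (hα : 0 < α) (hx : a < x)
    (hφ : ContinuousOn φ (Ici a)) :
    HasDerivAt (rlInt a (α + 1) φ) (rlInt a α φ x) x := by
  have hc := continuousOn_rlInt hα hφ
  have hI : Ici a ∈ nhds x := Ici_mem_nhds hx
  have h1 : HasDerivAt (fun y => ∫ t in a..y, rlInt a α φ t) (rlInt a α φ x) x := by
    refine intervalIntegral.integral_hasDerivAt_right ?_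
      (hc.mono Ioi_subset_Ici_self |>.stronglyMeasurableAtFilter isOpen_Ioi x hx)
      (hc.continuousAt hI)
    exact (hc.mono (by rw [uIcc_of_le hx.le]; exact Icc_subset_Ici_self)).intervalIntegrable
  refine h1.congr_of_eventuallyEq ?_
  filter_upwards [Ioi_mem_nhds hx] with y hy
  rw [← rlInt_rlInt hα one_pos hy hφ]
  simp [rlInt]

/-- Integration by parts. -/
lemma rlInt_eq_add_rlInt_add_one {a α x : ℝ} {g g' : ℝ → ℝ} (hα : 0 < α) (hx : a < x)
    (hg : ContinuousOn g (Ici a)) (hg' : ContinuousOn g' (Ici a))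
    (hd : ∀ y > a, HasDerivAt g (g' y) y) :
    rlInt a α g x = g a * ((x - a) ^ α / Real.Gamma (α + 1)) + rlInt a (α + 1) g' x := by
  have hs : uIcc a x ⊆ Ici a := by rw [uIcc_of_le hx.le]; exact Icc_subset_Ici_self
  have h := intervalIntegral.integral_mul_deriv_eq_deriv_mul_of_hasDerivAt
    (u := fun τ => (x - τ) ^ α) (u' := fun τ => -α * (x - τ) ^ (α - 1)) (v := g) (v' := g')
    (a := a) (b := x) (ContinuousOn.rpow_const (by fun_prop) fun _ _ => Or.inr hα.le)
    (hg.mono hs) (fun y hy => ?_) (fun y hy => hd y ?_)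
    ((intervalIntegrable_sub_rpow hα a x).const_mul _) (hg'.mono hs).intervalIntegrable
  · have h1 := (Real.Gamma_pos_of_pos hα).ne'
    simp only [sub_self, Real.zero_rpow hα.ne', zero_mul, zero_sub, mul_assoc,
      intervalIntegral.integral_const_mul] at h
    rw [rlInt, rlInt, add_sub_cancel_right, h, Real.Gamma_add_one hα.ne']
    field_simp
    ring
  · rw [min_eq_left hx.le, max_eq_right hx.le] at hy
    have h2 := ((hasDerivAt_id y).const_sub x).rpow_const (p := α)
      (Or.inl (sub_pos.2 hy.2).ne')
    simpa only [id, neg_one_mul] using h2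
  · rw [min_eq_left hx.le] at hy
    exact hy.1

lemma eq_zero_of_tendsto_sum_rpow {a β L : ℝ} {c : ℕ → ℝ} {n : ℕ} (hβ : ∀ k < n, β + k < 0)
    (h : Tendsto (fun x => ∑ k ∈ Finset.range n, c k * (x - a) ^ (β + k))
      (nhdsWithin a (Ioi a)) (nhds L)) :
    ∀ k < n, c k = 0 := by
  have h0 : ∀ {s : ℝ}, 0 < s → Tendsto (fun x => (x - a) ^ s) (nhdsWithin a (Ioi a)) (nhds 0) :=
    fun {s} hs => by
      have h1 : ContinuousAt (fun x : ℝ => (x - a) ^ s) a :=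
        ContinuousAt.rpow_const (by fun_prop) (Or.inr hs.le)
      simpa [ContinuousAt, Real.zero_rpow hs.ne'] using
        h1.tendsto.mono_left (nhdsWithin_le_nhds (s := Ioi a))
  intro k
  induction k using Nat.strong_induction_on with
  | _ k ih =>
    intro hk
    have h1 := h.mul (h0 (neg_pos.2 (hβ k hk)))
    have h2 : Tendsto (fun x => ∑ i ∈ Finset.range n, c i * (x - a) ^ ((i : ℝ) - k))
        (nhdsWithin a (Ioi a)) (nhds (∑ i ∈ Finset.range n, if i = k then c i else 0)) := by
      refine tendsto_finsetSum _ fun i hi => ?_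
      rcases lt_trichotomy i k with hik | rfl | hik
      · simp [ih i hik (Finset.mem_range.1 hi)]
      · simp
      · simpa [hik.ne'] using (h0 (sub_pos.2 (Nat.cast_lt (α := ℝ).2 hik))).const_mul (c i)
    have h3 := tendsto_nhds_unique (h2.congr' ?_) h1
    · simpa [hk] using h3
    · filter_upwards [self_mem_nhdsWithin] with x hx
      rw [Finset.sum_mul]
      refine Finset.sum_congr rfl fun i _ => ?_
      rw [mul_assoc, ← Real.rpow_add (sub_pos.2 hx)]
      congr 2
      ring

/-- The closed form, on `(a, ∞)`, of the `n`-th derivative of `rlInt a α (G 0)` when `G k` is the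
`k`-th derivative of `G 0`. -/
noncomputable def rlDeriv (a α : ℝ) (G : ℕ → ℝ → ℝ) (n : ℕ) (x : ℝ) : ℝ :=
  ∑ k ∈ Finset.range n, G k a * ((x - a) ^ (α - n + k) / Real.Gamma (α - n + k + 1)) +
    rlInt a α (G n) x

lemma ne_intCast_of_mem_Ioo {α : ℝ} (h0 : 0 < α) (h1 : α < 1) (n : ℤ) : α ≠ n := by
  rintro rfl
  norm_cast at h0 h1
  omega

lemma hasDerivAt_rpow_div_Gamma {a s x : ℝ} (hs : s ≠ 0) (hx : a < x) :
    HasDerivAt (fun y => (y - a) ^ s / Real.Gamma (s + 1))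
      ((x - a) ^ (s - 1) / Real.Gamma s) x := by
  have h := (((hasDerivAt_id x).sub_const a).rpow_const (p := s)
    (Or.inl (sub_pos.2 hx).ne')).div_const (Real.Gamma (s + 1))
  refine h.congr_deriv ?_
  rw [Real.Gamma_add_one hs, one_mul, id, mul_div_mul_left _ _ hs]

section

variable {a : ℝ} {m : ℕ} {G : ℕ → ℝ → ℝ}

lemma hasDerivAt_rlDeriv {α x : ℝ} {n : ℕ} (h0 : 0 < α) (h1 : α < 1)
    (hG : ∀ k ≤ m, ContinuousOn (G k) (Ici a))
    (hD : ∀ k < m, ∀ x > a, HasDerivAt (G k) (G (k + 1) x) x) (hn : n < m) (hx : a < x) :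
    HasDerivAt (rlDeriv a α G n) (rlDeriv a α G (n + 1) x) x := by
  have hS : HasDerivAt
      (fun x => ∑ k ∈ Finset.range n, G k a * ((x - a) ^ (α - n + k) / Real.Gamma (α - n + k + 1)))
      (∑ k ∈ Finset.range n, G k a * ((x - a) ^ (α - n + k - 1) / Real.Gamma (α - n + k))) x := by
    refine HasDerivAt.fun_sum fun k _ => ?_
    refine (hasDerivAt_rpow_div_Gamma (fun h => ?_) hx).const_mul _
    refine ne_intCast_of_mem_Ioo h0 h1 ((n : ℤ) - k) ?_
    push_cast
    linarith
  have hI : HasDerivAt (rlInt a α (G n))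
      (G n a * ((x - a) ^ (α - 1) / Real.Gamma α) + rlInt a α (G (n + 1)) x) x := by
    refine (((hasDerivAt_rpow_div_Gamma h0.ne' hx).const_mul _).add
      (hasDerivAt_rlInt_add_one h0 hx (hG _ hn))).congr_of_eventuallyEq ?_
    filter_upwards [Ioi_mem_nhds hx] with y hy
    exact rlInt_eq_add_rlInt_add_one h0 hy (hG _ hn.le) (hG _ hn) (hD n hn)
  refine (hS.add hI).congr_deriv ?_
  rw [rlDeriv, Finset.sum_range_succ, ← add_assoc]
  have e : ∀ k : ℕ, α - n + k - 1 = α - (n + 1 : ℕ) + k := fun k => by push_cast; ring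
  have e' : ∀ k : ℕ, α - n + k = α - (n + 1 : ℕ) + k + 1 := fun k => by push_cast; ring
  have e'' : α - 1 = α - (n + 1 : ℕ) + n := by push_cast; ring
  congr 2
  · refine Finset.sum_congr rfl fun k _ => ?_
    rw [e, e']
  · rw [← e'', sub_add_cancel]

lemma Isub_eq_exp_mul_rlInt {σ α : ℝ} (f : ℝ → ℝ) (hα : α ≠ 0) (x : ℝ) :
    Isub σ a α f x = Real.exp (-σ * x) * rlInt a α (fun τ => Real.exp (σ * τ) * f τ) x := by
  have h : ∀ τ, (x - τ) ^ (α - 1) * Real.exp (-σ * (x - τ)) * f τ =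
      Real.exp (-σ * x) * ((x - τ) ^ (α - 1) * (Real.exp (σ * τ) * f τ)) := fun τ => by
    have : Real.exp (-σ * (x - τ)) = Real.exp (-σ * x) * Real.exp (σ * τ) := by
      rw [← Real.exp_add]; ring_nf
    rw [this]
    ring
  simp only [Isub, if_neg hα, rlInt, h, intervalIntegral.integral_const_mul]
  exact mul_left_comm _ _ _

lemma iterate_Dsub_Isub {α σ : ℝ} {f : ℝ → ℝ} (h0 : 0 < α) (h1 : α < 1)
    (hG : ∀ k ≤ m, ContinuousOn (G k) (Ici a))
    (hD : ∀ k < m, ∀ x > a, HasDerivAt (G k) (G (k + 1) x) x)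
    (hf : G 0 = fun x => Real.exp (σ * x) * f x) {n : ℕ} (hn : n ≤ m) :
    ∀ x > a, (Dsub σ)^[n] (Isub σ a α f) x = Real.exp (-σ * x) * rlDeriv a α G n x := by
  induction n with
  | zero =>
    intro x _
    simp [Isub_eq_exp_mul_rlInt f h0.ne', rlDeriv, hf]
  | succ n ih =>
    intro x hx
    have he : HasDerivAt (fun x => Real.exp (-σ * x)) (Real.exp (-σ * x) * (-σ)) x := by
      simpa using ((hasDerivAt_id x).const_mul (-σ)).exp
    have hd := (he.mul (hasDerivAt_rlDeriv h0 h1 hG hD hn hx)).congr_of_eventuallyEq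
      (f₁ := (Dsub σ)^[n] (Isub σ a α f)) (by
        filter_upwards [Ioi_mem_nhds hx] with y hy using ih (Nat.le_of_succ_le hn) y hy)
    rw [Function.iterate_succ_apply', Dsub, hd.deriv, ih (Nat.le_of_succ_le hn) x hx]
    ring

lemma taylor_rlInt (hG : ∀ k ≤ m, ContinuousOn (G k) (Ici a))
    (hD : ∀ k < m, ∀ x > a, HasDerivAt (G k) (G (k + 1) x) x) {x : ℝ} (hx : a < x) {n : ℕ}
    (hn : n < m) :
    G 0 x = ∑ k ∈ Finset.range (n + 1), G k a * ((x - a) ^ (k : ℝ) / Real.Gamma (k + 1)) +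
      rlInt a (n + 1) (G (n + 1)) x := by
  induction n with
  | zero =>
    have h := intervalIntegral.integral_eq_sub_of_hasDerivAt_of_le hx.le
      ((hG 0 (Nat.zero_le _)).mono Icc_subset_Ici_self) (fun y hy => hD 0 hn y hy.1)
      (((hG 1 hn).mono (by rw [uIcc_of_le hx.le]; exact Icc_subset_Ici_self)).intervalIntegrable)
    simp only [zero_add] at h
    simp [rlInt, h]
  | succ n ih =>
    rw [ih (Nat.lt_of_succ_lt hn), Finset.sum_range_succ _ (n + 1), add_assoc,
      rlInt_eq_add_rlInt_add_one (by positivity) hx (hG _ hn.le) (hG _ hn) (hD _ hn)]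
    push_cast
    rfl

lemma rlInt_rlDeriv {α ν x : ℝ} {p : ℕ} (h0 : 0 < α) (hν : 0 < ν) (hαν : α + ν = p + 1)
    (hG : ∀ k ≤ p + 1, ContinuousOn (G k) (Ici a))
    (hD : ∀ k < p + 1, ∀ x > a, HasDerivAt (G k) (G (k + 1) x) x)
    (hz : ∀ k < p, G k a = 0) (hx : a < x) :
    rlInt a ν (rlDeriv a α G (p + 1)) x = G 0 x := by
  have hc := continuousOn_rlInt h0 (hG (p + 1) le_rfl)
  have h1 : rlDeriv a α G (p + 1) = fun τ =>
      G p a * ((τ - a) ^ (α - 1) / Real.Gamma α) + rlInt a α (G (p + 1)) τ := by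
    ext τ
    have e : α - (p + 1 : ℕ) + p = α - 1 := by push_cast; ring
    rw [rlDeriv, Finset.sum_range_succ, Finset.sum_eq_zero, zero_add, e, sub_add_cancel]
    intro k hk
    rw [hz k (Finset.mem_range.1 hk), zero_mul]
  have h2 : rlInt a ν (rlDeriv a α G (p + 1)) x =
      G p a * rlInt a ν (fun τ => (τ - a) ^ (α - 1) / Real.Gamma α) x +
        rlInt a ν (rlInt a α (G (p + 1))) x := by
    rw [h1]
    simp only [rlInt.eq_1 a ν, mul_add]
    rw [intervalIntegral.integral_add, mul_add]
    · simp only [mul_left_comm _ (G p a), intervalIntegral.integral_const_mul]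
    · have h3 := ((intervalIntegrable_sub_rpow_mul_rpow h0 hν hx).div_const
        (Real.Gamma α)).const_mul (G p a)
      refine h3.congr fun τ _ => ?_
      ring
    · exact intervalIntegrable_sub_rpow_mul hν hx.le hc
  rw [h2, rlInt_rpow h0 hν hx, rlInt_rlInt h0 hν hx (hG _ le_rfl), hαν,
    taylor_rlInt hG hD hx (Nat.lt_succ_self p), Finset.sum_range_succ, Finset.sum_eq_zero, zero_add,
    add_sub_cancel_right]
  intro k hk
  rw [hz k (Finset.mem_range.1 hk), zero_mul]

end

lemma DIfrac_sub_natCast {σ a ν : ℝ} (f : ℝ → ℝ) (hni : ∀ n : ℤ, ν ≠ (n : ℝ)) {j : ℕ}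
    (hj : j ≤ ⌈ν⌉₊) :
    DIfrac σ a (ν - j) f = (Dsub σ)^[⌈ν⌉₊ - j] (Isub σ a (⌈ν⌉₊ - ν) f) := by
  rw [DIfrac]
  split_ifs with h
  · rw [Dfrac, Nat.ceil_sub_natCast, Nat.cast_sub hj, sub_sub_sub_cancel_right]
  · have h1 : ν < j := lt_of_le_of_ne (by linarith) (by exact_mod_cast hni j)
    have h2 : j = ⌈ν⌉₊ := le_antisymm hj (Nat.ceil_le.2 h1.le)
    rw [h2, Nat.sub_self, neg_sub]
    rfl

/-- Lemma 2.7: `I_s^ν[D_s^ν f](x) = f(x) − Σ_{j=1}^m [D_s^{ν−j} f]_{x=a} (x−a)^{ν−j} e^{−σ(x−a)} / Γ(ν−j+1)`. -/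
theorem substantial_integral_of_substantial_derivative
    (σ a ν : ℝ) (hν : 0 < ν) (hni : ∀ n : ℤ, ν ≠ (n : ℝ)) (f : ℝ → ℝ)
    (hf : ContDiffOn ℝ ((⌈ν⌉₊ : ℕ) : ℕ∞) f (Set.Ici a))
    (hint : ∀ b > a, IntervalIntegrable (Dfrac σ a ν f) MeasureTheory.volume a b)
    (L : ℕ → ℝ)
    (hL : ∀ j ∈ Finset.Icc 1 ⌈ν⌉₊,
      Tendsto (DIfrac σ a (ν - (j : ℝ)) f) (nhdsWithin a (Set.Ioi a)) (nhds (L j))) :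
    ∀ x > a, Isub σ a ν (Dfrac σ a ν f) x =
      f x - ∑ j ∈ Finset.Icc 1 ⌈ν⌉₊, L j * (x - a) ^ (ν - (j : ℝ)) *
        Real.exp (-σ * (x - a)) / Real.Gamma (ν - (j : ℝ) + 1) := by
  obtain ⟨p, hp⟩ : ∃ p, ⌈ν⌉₊ = p + 1 := Nat.exists_eq_succ_of_ne_zero (Nat.ceil_pos.2 hν).ne'
  have hDI := fun j hj => DIfrac_sub_natCast (σ := σ) (a := a) f hni (j := j) hj
  set α : ℝ := ⌈ν⌉₊ - ν with hα
  have h0 : 0 < α :=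
    sub_pos.2 (lt_of_le_of_ne (Nat.le_ceil ν) (by exact_mod_cast hni ⌈ν⌉₊))
  have h1 : α < 1 := by have := Nat.ceil_lt_add_one hν.le; linarith
  have hDf : Dfrac σ a ν f = (Dsub σ)^[⌈ν⌉₊] (Isub σ a α f) := rfl
  have hαν : α + ν = p + 1 := by rw [hα, hp]; push_cast; ring
  clear_value α
  rw [hp] at hf hL hDI hDf ⊢
  have hU : UniqueDiffOn ℝ (Ici a) := uniqueDiffOn_Ici a
  have hg : ContDiffOn ℝ ((p + 1 : ℕ) : ℕ∞) (fun x => Real.exp (σ * x) * f x) (Ici a) :=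
    ContDiffOn.mul (by fun_prop) hf
  obtain ⟨G, hGdef⟩ : ∃ G : ℕ → ℝ → ℝ, G = fun k =>
    iteratedDerivWithin k (fun x => Real.exp (σ * x) * f x) (Ici a) := ⟨_, rfl⟩
  have hG : ∀ k ≤ p + 1, ContinuousOn (G k) (Ici a) := fun k hk => by
    rw [hGdef]
    exact hg.continuousOn_iteratedDerivWithin (by exact_mod_cast hk) hU
  have hD : ∀ k < p + 1, ∀ x > a, HasDerivAt (G k) (G (k + 1) x) x := fun k hk x hx => by
    rw [hGdef]
    simp only [iteratedDerivWithin_succ]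
    exact ((hg.differentiableOn_iteratedDerivWithin (by exact_mod_cast hk) hU) x
      hx.le).hasDerivWithinAt.hasDerivAt (Ici_mem_nhds hx)
  have hG0 : G 0 = fun x => Real.exp (σ * x) * f x := by rw [hGdef]; exact iteratedDerivWithin_zero
  have hE : ∀ x : ℝ, Real.exp (σ * x) * Real.exp (-σ * x) = 1 := fun x => by
    rw [← Real.exp_add]; simp
  have hlim : ∀ j ∈ Finset.Icc 1 (p + 1), Tendsto (rlDeriv a α G (p + 1 - j))
      (nhdsWithin a (Ioi a)) (nhds (Real.exp (σ * a) * L j)) := fun j hj => by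
    have hc : Tendsto (fun x => Real.exp (σ * x)) (nhdsWithin a (Ioi a))
        (nhds (Real.exp (σ * a))) :=
      (Continuous.tendsto (by fun_prop) a).mono_left nhdsWithin_le_nhds
    refine (hc.mul (hL j hj)).congr' ?_
    filter_upwards [self_mem_nhdsWithin] with x hx
    rw [hDI j (Finset.mem_Icc.1 hj).2,
      iterate_Dsub_Isub h0 h1 hG hD hG0 (Nat.sub_le _ _) x hx, ← mul_assoc, hE, one_mul]
  have hz : ∀ k < p, G k a = 0 := fun k hk => by
    have h2 := (hlim 1 (by simp)).sub (tendsto_rlInt_nhdsGT h0 (hG p (Nat.le_succ p)))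
    have h3 := eq_zero_of_tendsto_sum_rpow (a := a) (β := α - p) (n := p)
      (c := fun k => G k a / Real.Gamma (α - p + k + 1)) (fun i hi => ?_)
      (h2.congr fun x => ?_) k hk
    · refine (div_eq_zero_iff.1 h3).resolve_right (Real.Gamma_ne_zero fun i hi => ?_)
      refine ne_intCast_of_mem_Ioo h0 h1 ((p : ℤ) - k - 1 - i) ?_
      push_cast
      linarith
    · have : (i : ℝ) + 1 ≤ p := by exact_mod_cast hi
      linarith
    · simp only [Nat.add_sub_cancel, rlDeriv, add_sub_cancel_right]
      exact Finset.sum_congr rfl fun i _ => by ring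
  have hL0 : ∀ j ∈ Finset.Icc 1 (p + 1), L j = 0 := fun j hj => by
    have h2 := tendsto_nhds_unique ((hlim j hj).congr fun x => ?_)
      (tendsto_rlInt_nhdsGT h0 (hG (p + 1 - j) (Nat.sub_le _ _)))
    · exact (mul_eq_zero.1 h2).resolve_left (Real.exp_ne_zero _)
    · rw [rlDeriv, Finset.sum_eq_zero, zero_add]
      intro k hk
      have := (Finset.mem_Icc.1 hj).1
      have := Finset.mem_range.1 hk
      rw [hz k (by omega), zero_mul]
  intro x hx
  rw [Finset.sum_eq_zero fun j hj => by simp [hL0 j hj], sub_zero,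
    Isub_eq_exp_mul_rlInt _ hν.ne']
  have h2 : rlInt a ν (fun τ => Real.exp (σ * τ) * Dfrac σ a ν f τ) x =
      rlInt a ν (rlDeriv a α G (p + 1)) x := by
    rw [rlInt, rlInt, intervalIntegral.integral_of_le hx.le, intervalIntegral.integral_of_le hx.le]
    congr 1
    refine setIntegral_congr_fun measurableSet_Ioc fun τ hτ => ?_
    rw [hDf, iterate_Dsub_Isub h0 h1 hG hD hG0 le_rfl τ hτ.1, ← mul_assoc (Real.exp _), hE, one_mul]
  rw [h2, rlInt_rlDeriv h0 hν hαν hG hD hz hx, hG0, ← mul_assoc, mul_comm (Real.exp _), hE, one_mul]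
end

section
/- Let σ ∈ ℝ, a ∈ ℝ, μ > 0 and ν ≥ 0 with ν + 1 − μ not a nonpositive integer. Then for all x > a, the fractional substantial derivative of the function g(x) = e^{−σ(x−a)} (x−a)^ν satisfies D_s^μ g(x) = (Γ(ν+1)/Γ(ν+1−μ)) (x−a)^{ν−μ} e^{−σ(x−a)}. -/
open MeasureTheory Set

/-- The real Beta integral over `[0, b]` in terms of Gamma functions. -/
theorem integral_rpow_mul_sub_rpow {s t b : ℝ} (hs : 0 < s) (ht : 0 < t) (hb : 0 < b) :
    ∫ x in (0 : ℝ)..b, x ^ (s - 1) * (b - x) ^ (t - 1) =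
      b ^ (s + t - 1) * (Real.Gamma s * Real.Gamma t / Real.Gamma (s + t)) := by
  have hΓ : Complex.Gamma ((s : ℂ) + t) ≠ 0 := by
    rw [← Complex.ofReal_add, Complex.Gamma_ofReal]
    exact_mod_cast (Real.Gamma_pos_of_pos (add_pos hs ht)).ne'
  have hbeta : Complex.betaIntegral s t =
      Complex.Gamma s * Complex.Gamma t / Complex.Gamma ((s : ℂ) + t) := by
    rw [Complex.Gamma_mul_Gamma_eq_betaIntegral (by simpa using hs) (by simpa using ht),
      mul_div_cancel_left₀ _ hΓ]
  apply Complex.ofReal_injective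
  rw [← intervalIntegral.integral_ofReal]
  have hscaled := Complex.betaIntegral_scaled s t hb
  rw [hbeta, ← Complex.ofReal_add, Complex.Gamma_ofReal, Complex.Gamma_ofReal,
    Complex.Gamma_ofReal] at hscaled
  rw [Complex.ofReal_mul, Complex.ofReal_cpow hb.le]
  push_cast at hscaled ⊢
  rw [← hscaled]
  refine intervalIntegral.integral_congr fun x hx => ?_
  rw [uIcc_of_le hb.le] at hx
  rw [Complex.ofReal_cpow hx.1, Complex.ofReal_cpow (sub_nonneg.2 hx.2)]
  push_cast
  rfl

/-- The fractional substantial integral of an exponentially tempered power. -/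
theorem Isub_exp_mul_rpow (σ a : ℝ) {α ν x : ℝ} (hα : 0 ≤ α) (hν : -1 < ν) (hx : a < x) :
    Isub σ a α (fun t => Real.exp (-σ * (t - a)) * (t - a) ^ ν) x =
      Real.Gamma (ν + 1) / Real.Gamma (ν + α + 1) * (x - a) ^ (ν + α) *
        Real.exp (-σ * (x - a)) := by
  unfold Isub
  split_ifs with h
  · have hΓ : Real.Gamma (ν + 1) ≠ 0 := (Real.Gamma_pos_of_pos (by linarith)).ne'
    simp only [h, add_zero, div_self hΓ]
    ring
  · have hα' : 0 < α := lt_of_le_of_ne hα (Ne.symm h)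
    have hΓ : Real.Gamma α ≠ 0 := (Real.Gamma_pos_of_pos hα').ne'
    have hint : ∀ τ : ℝ, (x - τ) ^ (α - 1) * Real.exp (-σ * (x - τ)) *
        (Real.exp (-σ * (τ - a)) * (τ - a) ^ ν) =
        Real.exp (-σ * (x - a)) *
          ((τ - a) ^ (ν + 1 - 1) * ((x - a) - (τ - a)) ^ (α - 1)) := by
      intro τ
      rw [show -σ * (x - a) = -σ * (x - τ) + -σ * (τ - a) by ring, Real.exp_add,
        add_sub_cancel_right, sub_sub_sub_cancel_right]
      ring
    simp only [hint]
    rw [intervalIntegral.integral_const_mul,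
      intervalIntegral.integral_comp_sub_right
        (fun y => y ^ (ν + 1 - 1) * ((x - a) - y) ^ (α - 1)), sub_self,
      integral_rpow_mul_sub_rpow (by linarith) hα' (sub_pos.2 hx),
      show ν + 1 + α - 1 = ν + α by ring, show ν + 1 + α = ν + α + 1 by ring]
    field_simp

/-- One substantial derivative of an exponentially tempered power. -/
theorem Dsub_of_eqOn_rpow_mul_exp (σ a c β : ℝ) {f : ℝ → ℝ}
    (hf : ∀ x > a, f x = c * (x - a) ^ β * Real.exp (-σ * (x - a))) :
    ∀ x > a, Dsub σ f x = c * β * (x - a) ^ (β - 1) * Real.exp (-σ * (x - a)) := by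
  intro x hx
  have hsub : HasDerivAt (fun y : ℝ => y - a) 1 x := (hasDerivAt_id x).sub_const a
  have hpow := (hsub.rpow_const (p := β) (Or.inl (sub_pos.2 hx).ne')).const_mul c
  have hderiv := (hpow.mul (hsub.const_mul (-σ)).exp).congr_of_eventuallyEq
    (f₁ := f) (Filter.mem_of_superset (Ioi_mem_nhds hx) hf)
  rw [Dsub, hderiv.deriv, hf x hx]
  ring

/-- Iterated substantial derivatives of an exponentially tempered power. -/
theorem iterate_Dsub_of_eqOn_rpow_mul_exp (σ a c β : ℝ) (hβ : ∀ n : ℕ, β + 1 ≠ -(n : ℝ))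
    (k : ℕ) {f : ℝ → ℝ}
    (hf : ∀ x > a, f x =
      c / Real.Gamma (β + k + 1) * (x - a) ^ (β + k) * Real.exp (-σ * (x - a))) :
    ∀ x > a, (Dsub σ)^[k] f x =
      c / Real.Gamma (β + 1) * (x - a) ^ β * Real.exp (-σ * (x - a)) := by
  induction k generalizing f with
  | zero => simpa using hf
  | succ k ih =>
    refine ih fun x hx => ?_
    rw [Dsub_of_eqOn_rpow_mul_exp σ a _ _ hf x hx]
    have hne : β + k + 1 ≠ 0 := fun h => hβ k (by linarith)
    push_cast
    rw [← add_assoc, Real.Gamma_add_one hne, add_sub_cancel_right]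
    congr 2
    field_simp

/-- Eq. (2.9): `D_s^μ [e^{−σ(x−a)} (x−a)^ν] = (Γ(ν+1)/Γ(ν+1−μ)) (x−a)^{ν−μ} e^{−σ(x−a)}`. -/
theorem substantial_derivative_of_power
    (σ a μ ν : ℝ) (hμ : 0 < μ) (hν : 0 ≤ ν)
    (hpole : ∀ n : ℕ, ν + 1 - μ ≠ -(n : ℝ)) :
    ∀ x > a, Dfrac σ a μ (fun t => Real.exp (-σ * (t - a)) * (t - a) ^ ν) x =
      Real.Gamma (ν + 1) / Real.Gamma (ν + 1 - μ) * (x - a) ^ (ν - μ) *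
        Real.exp (-σ * (x - a)) := by
  rw [show ν + 1 - μ = ν - μ + 1 by ring]
  refine iterate_Dsub_of_eqOn_rpow_mul_exp σ a _ _ (fun n h => hpole n (by linarith)) _ fun x hx => ?_
  rw [Isub_exp_mul_rpow σ a (sub_nonneg.2 (Nat.le_ceil μ)) (by linarith) hx,
    show ν + ((⌈μ⌉₊ : ℝ) - μ) = ν - μ + ⌈μ⌉₊ by ring]
end
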